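/- arXiv:0803.0141 — 8 statements merged into one kernel-verified Lean document; each statement's English description precedes it below -/
import Mathlib

section
/- Let Y_1, …, Y_n and X_1, …, X_m be geodesic metric spaces, each containing more than one point, such that for every factor: (a) the complement of S (the set of points without the unique local geodesic property) is dense in that factor, and (b) there is an integer N ≥ 1 such that every two points of that factor are joined by at most N geodesics. If the sup-metric product Y_1 × ⋯ × Y_n is isometric to the sup-metric product X_1 × ⋯ × X_m, then m = n and there is a permutation σ of {1, …, n} such that Y_i is isometric to X_{σ(i)} for every i. -/
/-- The set of (globally length-minimizing, unit-speed) geodesics from `x` to `y` in a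
metric space: maps `γ : [0, dist x y] → X` with `γ 0 = x`, `γ (dist x y) = y`, and
`dist (γ s) (γ t) = |s - t|` for all `s, t`. -/
def GeodesicsFrom {X : Type*} [MetricSpace X] (x y : X) :
    Set (Set.Icc (0 : ℝ) (dist x y) → X) :=
  {γ | γ ⟨0, le_refl 0, dist_nonneg⟩ = x ∧
       γ ⟨dist x y, dist_nonneg, le_refl _⟩ = y ∧
       ∀ s t, dist (γ s) (γ t) = |s.1 - t.1|}

/-- A geodesic metric space: every two points are joined by at least one geodesic. -/
def IsGeodesicSpace (X : Type*) [MetricSpace X] : Prop :=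
  ∀ x y : X, (GeodesicsFrom x y).Nonempty

/-- `S(X)`: the set of points `z` of `X` every neighborhood of which contains two points
joined by more than one geodesic of `X`.  Its complement is the set of points with the
unique local geodesic property. -/
def BadSet (X : Type*) [MetricSpace X] : Set X :=
  {z | ∀ U ∈ nhds z, ∃ x ∈ U, ∃ y ∈ U, (GeodesicsFrom x y).Nontrivial}

/-- A finite product with the sup metric: points that agree off one coordinate are as far apart as
their values at that coordinate. -/
theorem dist_eq_of_forall_ne_eq {ι : Type*} [Fintype ι] {X : ι → Type*} [∀ i, MetricSpace (X i)]
    {x y : ∀ i, X i} (i : ι) (h : ∀ j, j ≠ i → x j = y j) : dist x y = dist (x i) (y i) := by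
  refine le_antisymm ((dist_pi_le_iff dist_nonneg).2 fun j => ?_) (dist_le_pi_dist x y i)
  by_cases hj : j = i
  · subst hj; rfl
  · rw [h j hj, dist_self]; exact dist_nonneg

theorem dist_update_update {ι : Type*} [Fintype ι] [DecidableEq ι] {X : ι → Type*}
    [∀ i, MetricSpace (X i)] (q : ∀ i, X i) (i : ι) (a b : X i) :
    dist (Function.update q i a) (Function.update q i b) = dist a b := by
  rw [dist_eq_of_forall_ne_eq i fun j hj => by simp [hj]]
  simp

/-- In a geodesic space, any two points are joined by an isometric path defined on `ℝ`. -/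
theorem IsGeodesicSpace.exists_path {X : Type*} [MetricSpace X] (hX : IsGeodesicSpace X)
    (x y : X) : ∃ c : ℝ → X, c 0 = x ∧ c (dist x y) = y ∧
      ∀ s ∈ Set.Icc 0 (dist x y), ∀ t ∈ Set.Icc 0 (dist x y), dist (c s) (c t) = |s - t| := by
  obtain ⟨γ, h0, h1, hγ⟩ := hX x y
  refine ⟨Set.IccExtend dist_nonneg γ, ?_, ?_, ?_⟩
  · rw [Set.IccExtend_of_mem _ _ ⟨le_rfl, dist_nonneg⟩, h0]
  · rw [Set.IccExtend_of_mem _ _ ⟨dist_nonneg, le_rfl⟩, h1]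
  · intro s hs t ht
    rw [Set.IccExtend_of_mem _ _ hs, Set.IccExtend_of_mem _ _ ht, hγ]

/-- In a geodesic space, two points lie in a connected set no point of which is farther from the
first point than the second one. -/
theorem IsGeodesicSpace.exists_isPreconnected {X : Type*} [MetricSpace X]
    (hX : IsGeodesicSpace X) (x y : X) :
    ∃ S : Set X, IsPreconnected S ∧ x ∈ S ∧ y ∈ S ∧ ∀ z ∈ S, dist z x ≤ dist y x := by
  obtain ⟨c, h0, h1, hc⟩ := hX.exists_path x y
  have hl : (0 : ℝ) ∈ Set.Icc 0 (dist x y) := ⟨le_rfl, dist_nonneg⟩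
  have hcont : ContinuousOn c (Set.Icc 0 (dist x y)) := by
    refine (LipschitzOnWith.of_dist_le_mul (K := 1) fun s hs t ht => ?_).continuousOn
    rw [hc s hs t ht, NNReal.coe_one, one_mul, Real.dist_eq]
  refine ⟨c '' Set.Icc 0 (dist x y), isPreconnected_Icc.image _ hcont, ⟨0, hl, h0⟩,
    ⟨_, ⟨dist_nonneg, le_rfl⟩, h1⟩, ?_⟩
  rintro _ ⟨t, ht, rfl⟩
  have := hc t ht 0 hl
  rw [h0, sub_zero, abs_of_nonneg ht.1] at this
  rw [this, dist_comm y x]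
  exact ht.2

theorem IsGeodesicSpace.preconnectedSpace {X : Type*} [MetricSpace X] (hX : IsGeodesicSpace X) :
    PreconnectedSpace X := by
  refine ⟨isPreconnected_of_forall_pair fun x _ y _ => ?_⟩
  obtain ⟨S, hS, hx, hy, -⟩ := hX.exists_isPreconnected x y
  exact ⟨S, Set.subset_univ _, hx, hy, hS⟩

/-- `z` is a midpoint of `x` and `y`, which are at distance `2 * L`. -/
structure IsMidpoint {X : Type*} [MetricSpace X] (L : ℝ) (x y z : X) : Prop where
  dist_left : dist z x = L
  dist_right : dist z y = L
  dist_ends : dist x y = 2 * L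

/-- Every midpoint of two points lies on a geodesic joining them. -/
theorem IsMidpoint.exists_geodesic {X : Type*} [MetricSpace X] (hX : IsGeodesicSpace X)
    {L : ℝ} {x y z : X} (h : IsMidpoint L x y z) (hL : L ∈ Set.Icc 0 (dist x y)) :
    ∃ γ ∈ GeodesicsFrom x y, γ ⟨L, hL⟩ = z := by
  obtain ⟨c, c0, c1, hc⟩ := hX.exists_path x z
  obtain ⟨e, e0, e1, he⟩ := hX.exists_path z y
  have hxz : dist x z = L := by rw [dist_comm, h.dist_left]
  have hzy : dist z y = L := h.dist_right
  have hxy := h.dist_ends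
  rw [hxz] at c1 hc
  rw [hzy] at e1 he
  have cross : ∀ s ∈ Set.Icc 0 L, ∀ t ∈ Set.Icc 0 L, dist (c s) (e t) = L + t - s := by
    intro s hs t ht
    have hL0 : 0 ≤ L := hL.1
    have h1 := hc 0 ⟨le_rfl, hL0⟩ s hs
    have h2 := hc s hs L ⟨hL0, le_rfl⟩
    have h3 := he 0 ⟨le_rfl, hL0⟩ t ht
    have h4 := he t ht L ⟨hL0, le_rfl⟩
    rw [c0, zero_sub, abs_neg, abs_of_nonneg hs.1] at h1
    rw [c1, abs_sub_comm, abs_of_nonneg (sub_nonneg.2 hs.2)] at h2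
    rw [e0, zero_sub, abs_neg, abs_of_nonneg ht.1] at h3
    rw [e1, abs_sub_comm, abs_of_nonneg (sub_nonneg.2 ht.2)] at h4
    have h5 := dist_triangle (c s) z (e t)
    have h6 := dist_triangle4 x (c s) (e t) y
    linarith
  refine ⟨fun t => if t.1 ≤ L then c t.1 else e (t.1 - L), ⟨?_, ?_, ?_⟩, ?_⟩
  · simp [hL.1, c0]
  · by_cases h0 : dist x y ≤ L
    · have : L = 0 := by linarith [hL.1]
      have hyz : z = y := dist_eq_zero.1 (hzy.trans this)
      have hd : dist x y = L := by linarith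
      simp only [hd, le_refl, if_true, c1, hyz]
    · have hd : dist x y - L = L := by linarith
      simp only [h0, if_false, hd, e1]
  · rintro ⟨s, hs⟩ ⟨t, ht⟩
    have hs2 := hs.2
    have ht2 := ht.2
    dsimp only
    split_ifs with h1 h2 h2
    · exact hc s ⟨hs.1, h1⟩ t ⟨ht.1, h2⟩
    · rw [cross s ⟨hs.1, h1⟩ (t - L) ⟨by linarith, by linarith⟩, abs_sub_comm,
        abs_of_nonneg (by linarith)]
      ring
    · rw [dist_comm, cross t ⟨ht.1, h2⟩ (s - L) ⟨by linarith, by linarith⟩,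
        abs_of_nonneg (by linarith)]
      ring
    · rw [he (s - L) ⟨by linarith, by linarith⟩ (t - L) ⟨by linarith, by linarith⟩]
      congr 1
      ring
  · simp [c1]

theorem finite_setOf_isMidpoint {X : Type*} [MetricSpace X] (hX : IsGeodesicSpace X)
    (L : ℝ) (x y : X) (hfin : (GeodesicsFrom x y).Finite) : {z | IsMidpoint L x y z}.Finite := by
  by_cases hL : L ∈ Set.Icc 0 (dist x y)
  · refine (hfin.image fun γ => γ ⟨L, hL⟩).subset fun z hz => ?_
    obtain ⟨γ, hγ, h⟩ := hz.exists_geodesic hX hL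
    exact ⟨γ, hγ, h⟩
  · refine Set.finite_empty.subset fun z hz => hL ?_
    have h0 : 0 ≤ L := hz.dist_left ▸ dist_nonneg
    exact ⟨h0, by linarith [hz.dist_ends]⟩

/-- A nontrivial geodesic space has midpoints of every small enough radius. -/
theorem IsGeodesicSpace.eventually_exists_isMidpoint {X : Type*} [MetricSpace X] [Nontrivial X]
    (hX : IsGeodesicSpace X) :
    ∀ᶠ L in nhdsWithin (0 : ℝ) (Set.Ioi 0), ∃ x y z : X, IsMidpoint L x y z := by
  obtain ⟨x, y, hxy⟩ := exists_pair_ne X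
  obtain ⟨c, -, -, hc⟩ := hX.exists_path x y
  filter_upwards [Ioo_mem_nhdsGT (half_pos (dist_pos.2 hxy))] with L hL
  have hL0 : 0 < L := hL.1
  have hL1 : L < dist x y / 2 := hL.2
  refine ⟨c 0, c (2 * L), c L, ?_, ?_, ?_⟩
  · rw [hc _ ⟨by linarith, by linarith⟩ _ ⟨by linarith, by linarith⟩, abs_of_nonneg] <;> linarith
  · rw [hc _ ⟨by linarith, by linarith⟩ _ ⟨by linarith, by linarith⟩, abs_of_nonpos] <;> linarith
  · rw [hc _ ⟨by linarith, by linarith⟩ _ ⟨by linarith, by linarith⟩, abs_of_nonpos] <;> linarith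

theorem exists_forall_isMidpoint {ι : Type*} [Finite ι] {X : ι → Type*} [∀ i, MetricSpace (X i)]
    [∀ i, Nontrivial (X i)] (hX : ∀ i, IsGeodesicSpace (X i)) :
    ∃ L > 0, ∃ q : ∀ i, X i, ∀ i, ∃ a b, IsMidpoint L a b (q i) := by
  obtain ⟨L, hL, hL0⟩ := ((Filter.eventually_all.2 fun i =>
    (hX i).eventually_exists_isMidpoint).and self_mem_nhdsWithin).exists
  choose a b q h using hL
  exact ⟨L, hL0, q, fun i => ⟨a i, b i, h i⟩⟩

/-- If a map from a geodesic space to a product is injective and, on balls of a fixed radius, moves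
only one coordinate, then it moves only one coordinate. -/
theorem exists_forall_ne_eq_of_local {Z κ : Type*} {X : κ → Type*} [MetricSpace Z]
    (hZ : IsGeodesicSpace Z) {F : Z → ∀ k, X k} (hF : Function.Injective F) {L : ℝ} (hL : 0 < L)
    (h : ∀ z, ∃ k₀, ∀ k, k ≠ k₀ → ∀ z', dist z' z ≤ L → F z' k = F z k) (z₀ : Z) :
    ∃ k₀, ∀ k, k ≠ k₀ → ∀ z, F z k = F z₀ k := by
  have := hZ.preconnectedSpace
  choose K hK using h
  have hKconst : IsLocallyConstant K := by
    refine (IsLocallyConstant.iff_eventually_eq K).2 fun z => ?_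
    filter_upwards [Metric.closedBall_mem_nhds z hL] with z' hz'
    rcases eq_or_ne z' z with rfl | hne
    · rfl
    obtain ⟨k, hk⟩ := Function.ne_iff.1 (hF.ne hne)
    have h1 : k = K z := by
      by_contra hkz
      exact hk (hK z k hkz z' hz')
    have h2 : k = K z' := by
      by_contra hkz
      exact hk (hK z' k hkz z (by rwa [dist_comm])).symm
    rw [← h1, ← h2]
  refine ⟨K z₀, fun k hk z => ?_⟩
  have hconst : IsLocallyConstant fun z => F z k := by
    refine (IsLocallyConstant.iff_eventually_eq _).2 fun z => ?_
    filter_upwards [Metric.closedBall_mem_nhds z hL] with z' hz'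
    exact hK z k (by rwa [hKconst.apply_eq_of_preconnectedSpace z z₀]) z' hz'
  exact hconst.apply_eq_of_preconnectedSpace z z₀

section Product

variable {ι κ : Type*} [Fintype ι] [Fintype κ] [DecidableEq ι]
  {Y : ι → Type*} {X : κ → Type*} [∀ i, MetricSpace (Y i)] [∀ k, MetricSpace (X k)]

/-- If `q j` is a midpoint of `a` and `b`, then some coordinate of an isometry preserves this
midpoint and does not change when the other coordinates of `q` move by at most `L`. -/
theorem exists_coord_forall_update_eq (hY : ∀ i, IsGeodesicSpace (Y i))
    (hX : ∀ k (L : ℝ) (x y : X k), {z | IsMidpoint L x y z}.Finite)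
    {f : (∀ i, Y i) → ∀ k, X k} (hf : Isometry f) {L : ℝ} (hL : 0 < L) (q : ∀ i, Y i) (j : ι)
    {a b : Y j} (hab : IsMidpoint L a b (q j)) :
    ∃ k, IsMidpoint L (f (Function.update q j a) k) (f (Function.update q j b) k) (f q k) ∧
      ∀ i, i ≠ j → ∀ z, dist z (q i) ≤ L → f (Function.update q i z) k = f q k := by
  set u := Function.update q j a with hu
  set v := Function.update q j b with hv
  have huv : dist (f u) (f v) = 2 * L := by
    rw [hf.dist_eq, hu, hv, dist_update_update, hab.dist_ends]
  obtain ⟨k, hk⟩ : ∃ k, 2 * L ≤ dist (f u k) (f v k) := by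
    by_contra! hlt
    have := (dist_pi_lt_iff (by linarith : 0 < 2 * L)).2 hlt
    linarith
  have hmid : ∀ p : ∀ i, Y i, p j = q j → (∀ i, dist (p i) (q i) ≤ L) →
      IsMidpoint L (f u k) (f v k) (f p k) := by
    intro p hpj hp
    have bound : ∀ c : Y j, dist (q j) c = L →
        dist (f p k) (f (Function.update q j c) k) ≤ L := by
      intro c hc
      refine (dist_le_pi_dist _ _ k).trans ?_
      rw [hf.dist_eq, dist_pi_le_iff hL.le]
      intro i
      by_cases hi : i = j
      · subst hi; rw [hpj, Function.update_self, hc]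
      · rw [Function.update_of_ne hi]; exact hp i
    have h1 := bound a hab.dist_left
    have h2 := bound b hab.dist_right
    have h3 := dist_triangle_left (f u k) (f v k) (f p k)
    have h4 := (dist_le_pi_dist (f u) (f v) k).trans_eq huv
    constructor <;> linarith
  refine ⟨k, hmid q rfl fun i => by simpa using hL.le, fun i hij z hz => ?_⟩
  obtain ⟨S, hS, hqS, hzS, hSd⟩ := (hY i).exists_isPreconnected (q i) z
  have hcont : Continuous fun w : Y i => f (Function.update q i w) k :=
    (continuous_apply k).comp (hf.continuous.comp (continuous_const.update i continuous_id))
  have himg := hS.image _ hcont.continuousOn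
  have hfin : ((fun w : Y i => f (Function.update q i w) k) '' S).Finite := by
    refine (hX k L (f u k) (f v k)).subset ?_
    rintro _ ⟨w, hw, rfl⟩
    refine hmid _ (Function.update_of_ne hij.symm _ _) fun l => ?_
    by_cases hl : l = i
    · subst hl; rw [Function.update_self]; exact (hSd w hw).trans hz
    · rw [Function.update_of_ne hl, dist_self]; exact hL.le
  have := hfin.countable.isTotallyDisconnected _ subset_rfl himg ⟨z, hzS, rfl⟩ ⟨q i, hqS, rfl⟩
  simpa using this

/-- The coordinates found at the midpoint coordinates of `q` are distinct. -/
theorem exists_injective_coord (hY : ∀ i, IsGeodesicSpace (Y i))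
    (hX : ∀ k (L : ℝ) (x y : X k), {z | IsMidpoint L x y z}.Finite)
    {f : (∀ i, Y i) → ∀ k, X k} (hf : Isometry f) {L : ℝ} (hL : 0 < L) (q : ∀ i, Y i)
    (s : Set ι) (hq : ∀ j ∈ s, ∃ a b, IsMidpoint L a b (q j)) :
    ∃ K : s → κ, Function.Injective K ∧
      (∀ j, ∃ x y, IsMidpoint L x y (f q (K j))) ∧
      ∀ j : s, ∀ i, i ≠ j.1 → ∀ z, dist z (q i) ≤ L →
        f (Function.update q i z) (K j) = f q (K j) := by
  choose a b hab using hq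
  choose K hmid hK using fun j : s =>
    exists_coord_forall_update_eq hY hX hf hL q j (hab j j.2)
  refine ⟨K, fun i j hij => ?_, fun j => ⟨_, _, hmid j⟩, hK⟩
  by_contra hne
  have hne' : (i : ι) ≠ j := fun h => hne (Subtype.ext h)
  have h1 := (hmid i).dist_left
  rw [hij, hK j i hne' _ (by rw [dist_comm, (hab i i.2).dist_left]), dist_self] at h1
  exact hL.ne h1

theorem card_le_of_isometry [∀ i, Nontrivial (Y i)] (hY : ∀ i, IsGeodesicSpace (Y i))
    (hX : ∀ k (L : ℝ) (x y : X k), {z | IsMidpoint L x y z}.Finite)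
    {f : (∀ i, Y i) → ∀ k, X k} (hf : Isometry f) : Fintype.card ι ≤ Fintype.card κ := by
  obtain ⟨L, hL, q, hq⟩ := exists_forall_isMidpoint hY
  obtain ⟨K, hK, -⟩ := exists_injective_coord hY hX hf hL q Set.univ fun j _ => hq j
  exact Fintype.card_le_of_injective (fun i => K ⟨i, trivial⟩) fun i j hij =>
    congrArg Subtype.val (hK hij)

/-- An isometry between products with equally many factors maps midpoints to midpoints. -/
theorem forall_isMidpoint_apply (hcard : Fintype.card ι = Fintype.card κ)
    (hY : ∀ i, IsGeodesicSpace (Y i))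
    (hX : ∀ k (L : ℝ) (x y : X k), {z | IsMidpoint L x y z}.Finite)
    {f : (∀ i, Y i) → ∀ k, X k} (hf : Isometry f) {L : ℝ} (hL : 0 < L) {q : ∀ i, Y i}
    (hq : ∀ j, ∃ a b, IsMidpoint L a b (q j)) (k : κ) : ∃ x y, IsMidpoint L x y (f q k) := by
  obtain ⟨K, hK, hmid, -⟩ := exists_injective_coord hY hX hf hL q Set.univ fun j _ => hq j
  have hinj : Function.Injective fun i => K ⟨i, trivial⟩ := fun i j hij =>
    congrArg Subtype.val (hK hij)
  obtain ⟨i, rfl⟩ := ((Fintype.bijective_iff_injective_and_card _).2 ⟨hinj, hcard⟩).2 k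
  exact hmid _

/-- An isometry between products with equally many factors maps the `i`-th slice through a
coordinatewise midpoint into a slice. -/
theorem exists_slice (hcard : Fintype.card ι = Fintype.card κ)
    (hY : ∀ i, IsGeodesicSpace (Y i))
    (hX : ∀ k (L : ℝ) (x y : X k), {z | IsMidpoint L x y z}.Finite)
    {f : (∀ i, Y i) → ∀ k, X k} (hf : Isometry f) {L : ℝ} (hL : 0 < L) {q : ∀ i, Y i}
    (hq : ∀ j, ∃ a b, IsMidpoint L a b (q j)) (i : ι) :
    ∃ k₀, ∀ k, k ≠ k₀ → ∀ z, f (Function.update q i z) k = f q k := by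
  have key := exists_forall_ne_eq_of_local (hY i)
    (hf.injective.comp (Function.update_injective q i)) hL (fun z => ?_) (q i)
  · simpa using key
  obtain ⟨K, hK, -, hconst⟩ := exists_injective_coord hY hX hf hL (Function.update q i z) {i}ᶜ
    fun j hj => by rw [Function.update_of_ne hj]; exact hq j
  have hrange : ∃ k₀, ∀ k, k ≠ k₀ → k ∈ Set.range K := by
    have h1 : (Set.range K)ᶜ.ncard = 1 := by
      have h2 := Set.ncard_add_ncard_compl (Set.range K)
      have h3 := Set.ncard_add_ncard_compl ({i} : Set ι)
      rw [← Set.image_univ, Set.ncard_image_of_injective _ hK, Set.ncard_univ,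
        Nat.card_coe_set_eq, Set.image_univ, Nat.card_eq_fintype_card] at h2
      rw [Set.ncard_singleton, Nat.card_eq_fintype_card] at h3
      omega
    obtain ⟨k₀, hk₀⟩ := Set.ncard_eq_one.1 h1
    refine ⟨k₀, fun k hk => ?_⟩
    by_contra hkr
    exact hk (by simpa [hk₀] using (show k ∈ (Set.range K)ᶜ from hkr))
  obtain ⟨k₀, hk₀⟩ := hrange
  refine ⟨k₀, fun k hk z' hz' => ?_⟩
  obtain ⟨j, rfl⟩ := hk₀ k hk
  have := hconst j i (fun h => j.2 h.symm) z' (by simpa using hz')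
  simpa using this

variable [DecidableEq κ]

/-- If `f` and its inverse map slices into slices, going there and back fixes the index. -/
theorem slice_index_leftInverse [∀ i, Nontrivial (Y i)] (f : (∀ i, Y i) ≃ᵢ ∀ k, X k)
    {q : ∀ i, Y i} {σ : ι → κ} {τ : κ → ι}
    (hσ : ∀ i k, k ≠ σ i → ∀ z, f (Function.update q i z) k = f q k)
    (hτ : ∀ k i, i ≠ τ k → ∀ z, f.symm (Function.update (f q) k z) i = q i) :
    Function.LeftInverse τ σ := by
  intro i
  by_contra hne
  obtain ⟨z, hz⟩ := exists_ne (q i)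
  have h1 : f (Function.update q i z) =
      Function.update (f q) (σ i) (f (Function.update q i z) (σ i)) :=
    Function.eq_update_iff.2 ⟨rfl, fun k hk => hσ i k hk z⟩
  have h2 := hτ (σ i) i (Ne.symm hne) (f (Function.update q i z) (σ i))
  rw [← h1, f.symm_apply_apply, Function.update_self] at h2
  exact hz h2

theorem exists_equiv_of_isometryEquiv [∀ i, Nontrivial (Y i)] [∀ k, Nontrivial (X k)]
    (hYgeo : ∀ i, IsGeodesicSpace (Y i)) (hXgeo : ∀ k, IsGeodesicSpace (X k))
    (hY : ∀ i (L : ℝ) (x y : Y i), {z | IsMidpoint L x y z}.Finite)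
    (hX : ∀ k (L : ℝ) (x y : X k), {z | IsMidpoint L x y z}.Finite)
    (f : (∀ i, Y i) ≃ᵢ ∀ k, X k) : ∃ σ : ι ≃ κ, ∀ i, Nonempty (Y i ≃ᵢ X (σ i)) := by
  have hcard : Fintype.card ι = Fintype.card κ :=
    (card_le_of_isometry hYgeo hX f.isometry).antisymm
      (card_le_of_isometry hXgeo hY f.symm.isometry)
  obtain ⟨L, hL, q, hq⟩ := exists_forall_isMidpoint hYgeo
  choose σ hσ using exists_slice hcard hYgeo hX f.isometry hL hq
  choose τ hτ using exists_slice hcard.symm hXgeo hY f.symm.isometry hL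
    (forall_isMidpoint_apply hcard hYgeo hX f.isometry hL hq)
  simp only [f.symm_apply_apply] at hτ
  have hτσ := slice_index_leftInverse f hσ hτ
  have hστ : Function.LeftInverse σ τ :=
    slice_index_leftInverse f.symm (q := f q) (by simpa using hτ) (by simpa using hσ)
  refine ⟨⟨σ, τ, hτσ, hστ⟩, fun i => ?_⟩
  have hiso : Isometry fun z => f (Function.update q i z) (σ i) := by
    refine Isometry.of_dist_eq fun z z' => ?_
    rw [← dist_eq_of_forall_ne_eq (σ i) fun k hk => by rw [hσ i k hk, hσ i k hk],
      f.isometry.dist_eq, dist_update_update]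
  refine ⟨IsometryEquiv.mk (Equiv.ofBijective _ ⟨hiso.injective, fun x => ?_⟩) hiso⟩
  set y := f.symm (Function.update (f q) (σ i) x) with hy
  have hyq : Function.update q i (y i) = y := by
    refine (Function.eq_update_iff.2 ⟨rfl, fun l hl => ?_⟩).symm
    exact hτ (σ i) l (by rwa [hτσ i]) x
  refine ⟨y i, ?_⟩
  simp only [hyq]
  rw [hy, f.apply_symm_apply, Function.update_self]

end Product

/-- Uniqueness of product decompositions: if `Y₁ × ⋯ × Yₙ` and `X₁ × ⋯ × Xₘ` (sup
metrics) are isometric, where all factors are geodesic metric spaces with more than one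
point, the complement of `S(·)` is dense in each factor, and each factor has an integer
bound on the number of geodesics joining any two of its points, then `m = n` and, after
a permutation of the factors, `Y i` is isometric to `X (σ i)` for every `i`. -/
theorem uniqueness_of_product_decomposition
    {n m : ℕ} (Y : Fin n → Type*) (X : Fin m → Type*)
    [∀ i, MetricSpace (Y i)] [∀ j, MetricSpace (X j)]
    [∀ i, Nontrivial (Y i)] [∀ j, Nontrivial (X j)]
    (hYgeo : ∀ i, IsGeodesicSpace (Y i)) (hXgeo : ∀ j, IsGeodesicSpace (X j))
    (hYdense : ∀ i, Dense (BadSet (Y i))ᶜ) (hXdense : ∀ j, Dense (BadSet (X j))ᶜ)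
    (hYbound : ∀ i, ∃ N : ℕ, 1 ≤ N ∧ ∀ x y : Y i,
      (GeodesicsFrom x y).Finite ∧ (GeodesicsFrom x y).ncard ≤ N)
    (hXbound : ∀ j, ∃ N : ℕ, 1 ≤ N ∧ ∀ x y : X j,
      (GeodesicsFrom x y).Finite ∧ (GeodesicsFrom x y).ncard ≤ N)
    (h : Nonempty ((∀ i, Y i) ≃ᵢ (∀ j, X j))) :
    m = n ∧ ∃ σ : Fin n ≃ Fin m, ∀ i, Nonempty (Y i ≃ᵢ X (σ i)) := by
  obtain ⟨f⟩ := h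
  have hY : ∀ i (L : ℝ) (x y : Y i), {z | IsMidpoint L x y z}.Finite := fun i L x y => by
    obtain ⟨N, -, hN⟩ := hYbound i
    exact finite_setOf_isMidpoint (hYgeo i) L x y (hN x y).1
  have hX : ∀ j (L : ℝ) (x y : X j), {z | IsMidpoint L x y z}.Finite := fun j L x y => by
    obtain ⟨N, -, hN⟩ := hXbound j
    exact finite_setOf_isMidpoint (hXgeo j) L x y (hN x y).1
  obtain ⟨σ, hσ⟩ := exists_equiv_of_isometryEquiv hYgeo hXgeo hY hX f
  exact ⟨by simpa using (Fintype.card_congr σ).symm, σ, hσ⟩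
end

section
/- Let Y = Y_1 × ⋯ × Y_m (m ≥ 1) be a product of metric spaces with the sup metric, and let p = (p_1,…,p_m) and q = (q_1,…,q_m) be a diagonal pair. If for each index i there is exactly one geodesic in Y_i from p_i to q_i, then there is exactly one geodesic in Y from p to q. -/
/-- A map `g` on `[0, L]` is a unit-speed geodesic from `x` to `y`, the parameter length `L` being
independent of `dist x y`. -/
def IsGeodesicOn {X : Type*} [MetricSpace X] (L : ℝ) (x y : X) (g : Set.Icc (0 : ℝ) L → X) : Prop :=
  (∀ s, s.1 = 0 → g s = x) ∧ (∀ s, s.1 = L → g s = y) ∧ ∀ s t, dist (g s) (g t) = |s.1 - t.1|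

theorem existsUnique_geodesicsFrom_iff {X : Type*} [MetricSpace X] {x y : X} {L : ℝ}
    (hL : dist x y = L) :
    (∃! g, g ∈ GeodesicsFrom x y) ↔ ∃! g, IsGeodesicOn L x y g := by
  subst hL
  refine existsUnique_congr fun g => ⟨fun h => ⟨?_, ?_, h.2.2⟩,
    fun h => ⟨h.1 _ rfl, h.2.1 _ rfl, h.2.2⟩⟩
  · rintro ⟨s, hs⟩ rfl
    exact h.1
  · rintro ⟨s, hs⟩ rfl
    exact h.2.1

/-- A `1`-Lipschitz path on `[0, L]` whose endpoints are at distance `L` is a geodesic. -/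
theorem isGeodesicOn_of_dist_le {X : Type*} [MetricSpace X] {x y : X} {L : ℝ} (hL : dist x y = L)
    {g : Set.Icc (0 : ℝ) L → X} (h0 : ∀ s, s.1 = 0 → g s = x) (h1 : ∀ s, s.1 = L → g s = y)
    (hg : ∀ s t, dist (g s) (g t) ≤ |s.1 - t.1|) : IsGeodesicOn L x y g := by
  have hL0 : 0 ≤ L := hL ▸ dist_nonneg
  have key : ∀ s t : Set.Icc (0 : ℝ) L, s.1 ≤ t.1 → dist (g s) (g t) = |s.1 - t.1| := by
    intro s t hst
    refine le_antisymm (hg s t) ?_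
    have ha := hg ⟨0, le_rfl, hL0⟩ s
    have hb := hg t ⟨L, hL0, le_rfl⟩
    rw [h0 ⟨0, le_rfl, hL0⟩ rfl, abs_of_nonpos (by linarith [s.2.1])] at ha
    rw [h1 ⟨L, hL0, le_rfl⟩ rfl, abs_of_nonpos (by linarith [t.2.2])] at hb
    rw [abs_of_nonpos (by linarith)]
    linarith [dist_triangle4 x (g s) (g t) y]
  refine ⟨h0, h1, fun s t => ?_⟩
  rcases le_total s.1 t.1 with h | h
  · exact key s t h
  · rw [dist_comm, abs_sub_comm, key t s h]

/-- If `p, q` is a diagonal pair in a sup-metric product and each coordinate pair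
`p i, q i` is joined by exactly one geodesic in `Y i`, then `p` and `q` are joined by
exactly one geodesic in the product. -/
theorem unique_geodesic_of_diagonal_pair
    {m : ℕ} (hm : 1 ≤ m) (Y : Fin m → Type*) [∀ i, MetricSpace (Y i)]
    (p q : ∀ i, Y i)
    (hdiag : ∀ i j, dist (p i) (q i) = dist (p j) (q j))
    (huniq : ∀ i, ∃! g, g ∈ GeodesicsFrom (p i) (q i)) :
    ∃! γ, γ ∈ GeodesicsFrom p q := by
  let i₀ : Fin m := ⟨0, hm⟩
  have hdist : ∀ i, dist (p i) (q i) = dist p q := fun i =>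
    le_antisymm (dist_le_pi_dist p q i)
      ((dist_pi_le_iff dist_nonneg).2 fun j => (hdiag j i).le)
  have hcoord i := (existsUnique_geodesicsFrom_iff (hdist i)).1 (huniq i)
  choose g hg hg' using hcoord
  refine (existsUnique_geodesicsFrom_iff rfl).2
    ⟨fun s i => g i s, ⟨fun s hs => funext fun i => (hg i).1 s hs,
      fun s hs => funext fun i => (hg i).2.1 s hs, fun s t => ?_⟩, fun γ hγ => ?_⟩
  · refine le_antisymm ((dist_pi_le_iff (abs_nonneg _)).2 fun i => ((hg i).2.2 s t).le) ?_
    rw [← (hg i₀).2.2 s t]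
    exact dist_le_pi_dist (fun i => g i s) (fun i => g i t) i₀
  · have h i : (fun s => γ s i) = g i :=
      hg' i _ (isGeodesicOn_of_dist_le (hdist i) (fun s hs => congrFun (hγ.1 s hs) i)
        (fun s hs => congrFun (hγ.2.1 s hs) i)
        fun s t => (dist_le_pi_dist (γ s) (γ t) i).trans (hγ.2.2 s t).le)
    exact funext fun s => funext fun i => congrFun (h i) s
end

section
/- Let Y_1, …, Y_m (m ≥ 2) be geodesic metric spaces, each containing more than one point, and give Y = Y_1 × ⋯ × Y_m the sup metric. If p, q ∈ Y are distinct points that do NOT form a diagonal pair, then the set of geodesics in Y from p to q is infinite. -/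
/-- Extending a geodesic to the whole real line by constants gives a `1`-Lipschitz map. -/
theorem IsGeodesicSpace.exists_extension {X : Type*} [MetricSpace X] (h : IsGeodesicSpace X)
    (x y : X) :
    ∃ f : ℝ → X, (∀ t ≤ 0, f t = x) ∧ (∀ t, dist x y ≤ t → f t = y) ∧
      (∀ s t, dist (f s) (f t) ≤ |s - t|) ∧
      ∀ s ∈ Set.Icc 0 (dist x y), ∀ t ∈ Set.Icc 0 (dist x y), dist (f s) (f t) = |s - t| := by
  obtain ⟨γ, h0, h1, hd⟩ := h x y
  have hL : (0 : ℝ) ≤ dist x y := dist_nonneg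
  refine ⟨fun t => γ (Set.projIcc 0 (dist x y) hL t), fun t ht => ?_, fun t ht => ?_,
    fun s t => ?_, fun s hs t ht => ?_⟩
  · simpa only [Set.projIcc_of_le_left hL ht] using h0
  · simpa only [Set.projIcc_of_right_le hL ht] using h1
  · rw [hd]
    exact Set.abs_projIcc_sub_projIcc hL
  · simp only [Set.projIcc_of_mem hL hs, Set.projIcc_of_mem hL ht, hd]

/-- In a nontrivial geodesic space, two points are joined by infinitely many `1`-Lipschitz paths
parametrized by an interval longer than their distance. -/
theorem IsGeodesicSpace.infinite_lipschitz_paths {X : Type*} [MetricSpace X] [Nontrivial X]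
    (h : IsGeodesicSpace X) (x y : X) {D : ℝ} (hD : 0 ≤ D) (hxy : dist x y < D) :
    {f : Set.Icc (0 : ℝ) D → X | f ⟨0, le_rfl, hD⟩ = x ∧ f ⟨D, hD, le_rfl⟩ = y ∧
      ∀ s t, dist (f s) (f t) ≤ |s.1 - t.1|}.Infinite := by
  rcases eq_or_ne x y with rfl | hne
  · rw [dist_self] at hxy
    obtain ⟨r, hr⟩ := exists_ne x
    have hL : 0 < dist x r := dist_pos.2 hr.symm
    obtain ⟨f, f0, -, flip, fiso⟩ := h.exists_extension x r
    have hpos : 0 < min (dist x r) (D / 2) := lt_min hL (by linarith)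
    refine Set.infinite_of_injOn_mapsTo (s := Set.Ioo 0 (min (dist x r) (D / 2)))
      (f := fun c t => f (min (min t.1 (D - t.1)) c)) ?_ ?_ (Set.Ioo_infinite hpos)
    · intro a ha b hb hab
      have e := congrFun hab ⟨D / 2, by linarith, by linarith⟩
      obtain ⟨ha0, ha1⟩ := ha
      obtain ⟨hb0, hb1⟩ := hb
      rw [lt_min_iff] at ha1 hb1
      have key : ∀ c, c < D / 2 → min (min (D / 2) (D - D / 2)) c = c := fun c hc =>
        min_eq_right (le_min hc.le (by linarith))
      simp only [key a ha1.2, key b hb1.2] at e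
      have e' := fiso a ⟨ha0.le, ha1.1.le⟩ b ⟨hb0.le, hb1.1.le⟩
      rw [e, dist_self] at e'
      exact sub_eq_zero.1 (abs_eq_zero.1 e'.symm)
    · intro c hc
      refine ⟨f0 _ ?_, f0 _ ?_, fun s t => (flip _ _).trans ?_⟩
      · exact (min_le_left _ _).trans (min_le_left _ _)
      · exact (min_le_left _ _).trans ((min_le_right _ _).trans (by simp))
      · refine (abs_min_sub_min_le_max _ _ _ _).trans (max_le ?_ (by simp))
        refine (abs_min_sub_min_le_max _ _ _ _).trans (max_le le_rfl ?_)
        rw [abs_sub_comm s.1]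
        exact le_of_eq (congrArg _ (by ring))
  · have hL : 0 < dist x y := dist_pos.2 hne
    obtain ⟨f, f0, f1, flip, fiso⟩ := h.exists_extension x y
    refine Set.infinite_of_injOn_mapsTo (s := Set.Ioo 0 (D - dist x y))
      (f := fun a t => f (t.1 - a)) ?_ ?_ (Set.Ioo_infinite (by linarith))
    · have key : ∀ a ∈ Set.Ioo 0 (D - dist x y), ∀ b ∈ Set.Ioo 0 (D - dist x y), a < b →
          (fun t : Set.Icc (0 : ℝ) D => f (t.1 - a)) ≠ fun t => f (t.1 - b) := by
        intro a ha b hb hlt hab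
        have hm : 0 < min (b - a) (dist x y) := lt_min (by linarith) hL
        have hm1 : min (b - a) (dist x y) ≤ b - a := min_le_left _ _
        have hm2 : min (b - a) (dist x y) ≤ dist x y := min_le_right _ _
        have e := congrFun hab ⟨a + min (b - a) (dist x y),
          by linarith [ha.1], by linarith [ha.2]⟩
        simp only [add_sub_cancel_left] at e
        rw [f0 (_ - b) (by linarith)] at e
        have e' := fiso _ ⟨hm.le, hm2⟩ 0 ⟨le_rfl, hL.le⟩
        rw [e, f0 0 le_rfl, dist_self, sub_zero, abs_of_pos hm] at e'
        exact hm.ne e'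
      intro a ha b hb hab
      rcases lt_trichotomy a b with hlt | heq | hlt
      · exact absurd hab (key a ha b hb hlt)
      · exact heq
      · exact absurd hab.symm (key b hb a ha hlt)
    · intro a ha
      refine ⟨f0 _ (by linarith [ha.1]), f1 _ (by linarith [ha.2]),
        fun s t => (flip _ _).trans (by simp)⟩

/-- In a sup-metric product of at least two geodesic metric spaces, each with more than
one point, any pair of distinct points which is NOT a diagonal pair is joined by
infinitely many geodesics. -/
theorem infinite_geodesics_of_not_diagonal_pair
    {m : ℕ} (hm : 2 ≤ m) (Y : Fin m → Type*) [∀ i, MetricSpace (Y i)]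
    [∀ i, Nontrivial (Y i)]
    (hgeo : ∀ i, IsGeodesicSpace (Y i))
    (p q : ∀ i, Y i) (hpq : p ≠ q)
    (hnotdiag : ¬ ∀ i j, dist (p i) (q i) = dist (p j) (q j)) :
    (GeodesicsFrom p q).Infinite := by
  have : Nonempty (Fin m) := ⟨⟨0, by omega⟩⟩
  have hle : ∀ k, dist (p k) (q k) ≤ dist p q := dist_le_pi_dist p q
  obtain ⟨i, hi⟩ : ∃ i, dist (p i) (q i) = dist p q := by
    obtain ⟨i, hi⟩ := Finite.exists_max fun k => dist (p k) (q k)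
    exact ⟨i, (hle i).antisymm ((dist_pi_le_iff dist_nonneg).2 hi)⟩
  obtain ⟨j, hj⟩ : ∃ j, dist (p j) (q j) < dist p q := by
    by_contra! hcon
    exact hnotdiag fun a b =>
      ((hle a).antisymm (hcon a)).trans ((hle b).antisymm (hcon b)).symm
  have hij : i ≠ j := by
    rintro rfl
    exact hj.ne hi
  choose f f0 f1 flip fiso using fun k => (hgeo k).exists_extension (p k) (q k)
  refine Set.infinite_of_injOn_mapsTo (f := fun g t => Function.update (fun k => f k t.1) j (g t))
    ?_ ?_ ((hgeo j).infinite_lipschitz_paths (p j) (q j) dist_nonneg hj)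
  · intro g _ g' _ hgg
    funext t
    simpa using congrFun (congrFun hgg t) j
  · rintro g ⟨g0, g1, glip⟩
    refine ⟨?_, ?_, fun s t => le_antisymm ?_ ?_⟩
    · funext k
      rcases eq_or_ne k j with rfl | hk
      · simpa using g0
      · simpa [hk] using f0 k 0 le_rfl
    · funext k
      rcases eq_or_ne k j with rfl | hk
      · simpa using g1
      · simpa [hk] using f1 k _ (hle k)
    · refine (dist_pi_le_iff (abs_nonneg _)).2 fun k => ?_
      rcases eq_or_ne k j with rfl | hk
      · simpa using glip s t
      · simpa [hk] using flip k s t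
    · have e := fiso i s.1 (by rw [hi]; exact s.2) t.1 (by rw [hi]; exact t.2)
      rw [← e]
      refine le_trans (le_of_eq ?_) (dist_le_pi_dist _ _ i)
      simp [hij]
end

section
/- Let Y_1, …, Y_m (m ≥ 1) be geodesic metric spaces, each containing more than one point, and suppose for each i there is an integer N_i ≥ 1 such that every two points of Y_i are joined by at most N_i geodesics. Give Y = Y_1 × ⋯ × Y_m the sup metric. Then for a point z = (z_1,…,z_m) ∈ Y, the following are equivalent: (a) z_i ∈ S(Y_i) for some index i; (b) there exists an integer N > 1 such that every neighborhood of z in Y contains two points x, y that are joined by more than one but at most N geodesics of Y. Moreover, in (b) one can always take N = N_1 · N_2 ⋯ N_m. -/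
open Set

/-- The `1`-Lipschitz paths `[0, D] → X` from `x` to `y`. -/
def LipschitzPaths {X : Type*} [MetricSpace X] {D : ℝ} (hD : 0 ≤ D) (x y : X) :
    Set (Icc (0 : ℝ) D → X) :=
  {γ | γ ⟨0, le_refl 0, hD⟩ = x ∧ γ ⟨D, hD, le_refl _⟩ = y ∧
       ∀ s t, dist (γ s) (γ t) ≤ |s.1 - t.1|}

/-- A `1`-Lipschitz path from `x` to `y` of duration `dist x y` is a geodesic. -/
theorem geodesicsFrom_eq_lipschitzPaths {X : Type*} [MetricSpace X] (x y : X) :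
    GeodesicsFrom x y = LipschitzPaths dist_nonneg x y := by
  ext γ
  refine ⟨fun h => ⟨h.1, h.2.1, fun s t => (h.2.2 s t).le⟩, fun ⟨h0, h1, h⟩ => ⟨h0, h1, ?_⟩⟩
  have key : ∀ s t : Icc (0 : ℝ) (dist x y), s ≤ t → dist (γ s) (γ t) = |s.1 - t.1| := by
    intro s t hst
    refine le_antisymm (h s t) ?_
    have a := h ⟨0, le_refl 0, dist_nonneg⟩ s
    have b := h t ⟨dist x y, dist_nonneg, le_refl _⟩
    have c := dist_triangle4 x (γ s) (γ t) y
    rw [h0, zero_sub, abs_neg, abs_of_nonneg s.2.1] at a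
    rw [h1, abs_of_nonpos (sub_nonpos.2 t.2.2)] at b
    rw [abs_of_nonpos (sub_nonpos.2 (Subtype.coe_le_coe.2 hst))]
    linarith
  intro s t
  rcases le_total s t with hst | hst
  · exact key s t hst
  · rw [dist_comm, abs_sub_comm]
    exact key t s hst

theorem geodesicsFrom_eq_lipschitzPaths_of_eq {X : Type*} [MetricSpace X] {x y : X} {D : ℝ}
    (hD : 0 ≤ D) (h : dist x y = D) (P : (D : ℝ) → Set (Icc (0 : ℝ) D → X) → Prop) :
    P (dist x y) (GeodesicsFrom x y) ↔ P D (LipschitzPaths hD x y) := by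
  subst h
  rw [geodesicsFrom_eq_lipschitzPaths]

/-- Composing a geodesic with a `1`-Lipschitz real function, clamped to the domain. -/
theorem comp_projIcc_mem_lipschitzPaths {X : Type*} [MetricSpace X] {x w : X}
    {g : Icc (0 : ℝ) (dist x w) → X} (hg : g ∈ GeodesicsFrom x w) {D : ℝ} (hD : 0 ≤ D)
    {φ : ℝ → ℝ} (hφ : ∀ s t, |φ s - φ t| ≤ |s - t|) :
    (fun t : Icc (0 : ℝ) D => g (projIcc 0 (dist x w) dist_nonneg (φ t))) ∈
      LipschitzPaths hD (g (projIcc 0 (dist x w) dist_nonneg (φ 0)))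
        (g (projIcc 0 (dist x w) dist_nonneg (φ D))) := by
  refine ⟨rfl, rfl, fun s t => ?_⟩
  rw [hg.2.2]
  exact (abs_projIcc_sub_projIcc dist_nonneg).trans (hφ s t)

theorem eq_of_apply_eq_of_mem_geodesicsFrom {X : Type*} [MetricSpace X] {x w : X}
    {g : Icc (0 : ℝ) (dist x w) → X} (hg : g ∈ GeodesicsFrom x w)
    {s t : Icc (0 : ℝ) (dist x w)} (h : g s = g t) : s = t := by
  have := hg.2.2 s t
  rw [h, dist_self] at this
  exact Subtype.ext (sub_eq_zero.1 (abs_eq_zero.1 this.symm))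

theorem delayed_mem_lipschitzPaths {X : Type*} [MetricSpace X] {x y : X}
    {g : Icc (0 : ℝ) (dist x y) → X} (hg : g ∈ GeodesicsFrom x y) {D : ℝ} (hD : 0 ≤ D)
    {s : ℝ} (hs : 0 ≤ s) (hsD : s ≤ D - dist x y) :
    (fun t : Icc (0 : ℝ) D => g (projIcc 0 (dist x y) dist_nonneg (t - s))) ∈
      LipschitzPaths hD x y := by
  have h := comp_projIcc_mem_lipschitzPaths hg hD (φ := fun t => t - s) (by simp)
  rwa [projIcc_of_le_left _ (by linarith), projIcc_of_right_le _ (by linarith), hg.1, hg.2.1] at h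

theorem lipschitzPaths_nonempty {X : Type*} [MetricSpace X] (hX : IsGeodesicSpace X) {x y : X}
    {D : ℝ} (hD : 0 ≤ D) (h : dist x y ≤ D) : (LipschitzPaths hD x y).Nonempty := by
  obtain ⟨g, hg⟩ := hX x y
  exact ⟨_, delayed_mem_lipschitzPaths hg hD le_rfl (sub_nonneg.2 h)⟩

/-- There are infinitely many `1`-Lipschitz paths of duration exceeding the distance. -/
theorem lipschitzPaths_infinite {X : Type*} [MetricSpace X] [Nontrivial X]
    (hX : IsGeodesicSpace X) {x y : X} {D : ℝ} (hD : 0 ≤ D) (h : dist x y < D) :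
    (LipschitzPaths hD x y).Infinite := by
  rcases eq_or_ne x y with rfl | hxy
  · rw [dist_self] at h
    obtain ⟨w, hw⟩ := exists_ne x
    have hxw : 0 < dist x w := dist_pos.2 hw.symm
    obtain ⟨g, hg⟩ := hX x w
    have hpos : 0 < min (D / 2) (dist x w) := lt_min (by linarith) hxw
    refine infinite_of_injOn_mapsTo (s := Icc 0 (min (D / 2) (dist x w)))
      (f := fun s (t : Icc (0 : ℝ) D) =>
        g (projIcc 0 (dist x w) dist_nonneg (min (min (t : ℝ) (D - t)) s))) ?_ ?_
      (Icc_infinite hpos)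
    · intro s hs s' hs' hss
      have e := eq_of_apply_eq_of_mem_geodesicsFrom hg
        (congrFun hss ⟨D / 2, by linarith, by linarith⟩)
      have aux : ∀ u ∈ Icc 0 (min (D / 2) (dist x w)),
          ((projIcc 0 (dist x w) dist_nonneg (min (min (D / 2) (D - D / 2)) u) :
            Icc (0 : ℝ) (dist x w)) : ℝ) = u := by
        rintro u ⟨hu0, hu⟩
        rw [le_min_iff] at hu
        rw [min_eq_right (by rw [le_min_iff]; constructor <;> linarith),
          projIcc_of_mem _ ⟨hu0, hu.2⟩]
      have e' := congrArg Subtype.val e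
      dsimp only at e'
      rwa [aux s hs, aux s' hs'] at e'
    · intro s hs
      have h := comp_projIcc_mem_lipschitzPaths hg hD (φ := fun t => min (min t (D - t)) s) (by
        intro a b
        refine (abs_min_sub_min_le_max _ _ _ _).trans (max_le ?_ (by simp))
        refine (abs_min_sub_min_le_max _ _ _ _).trans (max_le le_rfl ?_)
        rw [sub_sub_sub_cancel_left, abs_sub_comm])
      have h0 : min (min 0 (D - 0)) s ≤ 0 := (min_le_left _ _).trans (min_le_left _ _)
      have h1 : min (min D (D - D)) s ≤ 0 :=
        (min_le_left _ _).trans ((min_le_right _ _).trans (sub_self D).le)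
      rwa [projIcc_of_le_left _ h0, projIcc_of_le_left _ h1, hg.1] at h
  · have hd : 0 < dist x y := dist_pos.2 hxy
    obtain ⟨g, hg⟩ := hX x y
    refine infinite_of_injOn_mapsTo (s := Icc 0 (D - dist x y))
      (f := fun s (t : Icc (0 : ℝ) D) => g (projIcc 0 (dist x y) dist_nonneg (t - s))) ?_
      (fun s hs => delayed_mem_lipschitzPaths hg hD hs.1 hs.2) (Icc_infinite (sub_pos.2 h))
    have key : ∀ s ∈ Icc 0 (D - dist x y), ∀ s' ∈ Icc 0 (D - dist x y),
        (∀ t : Icc (0 : ℝ) D, g (projIcc 0 (dist x y) dist_nonneg (t - s)) =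
          g (projIcc 0 (dist x y) dist_nonneg (t - s'))) → s' ≤ s := by
      intro s hs s' hs' hss
      by_contra! hlt
      have e := eq_of_apply_eq_of_mem_geodesicsFrom hg (hss ⟨s', hs'.1, by linarith [hs'.2]⟩)
      rw [sub_self, projIcc_left, projIcc_eq_left hd] at e
      linarith
    intro s hs s' hs' hss
    exact le_antisymm (key s' hs' s hs fun t => (congrFun hss t).symm)
      (key s hs s' hs' (congrFun hss))

section Pi

variable {ι : Type*} [Fintype ι] {Y : ι → Type*} [∀ i, MetricSpace (Y i)]

/-- Geodesics in a sup-metric product are the tuples of `1`-Lipschitz paths in the factors. -/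
theorem image_geodesicsFrom_pi (x y : ∀ i, Y i) :
    (Equiv.piComm fun (_ : Icc (0 : ℝ) (dist x y)) i => Y i) '' GeodesicsFrom x y =
      univ.pi fun i => LipschitzPaths dist_nonneg (x i) (y i) := by
  ext γ
  rw [Equiv.image_eq_preimage_symm, mem_preimage, geodesicsFrom_eq_lipschitzPaths, mem_univ_pi]
  constructor
  · rintro ⟨h0, h1, h⟩ i
    exact ⟨congrFun h0 i, congrFun h1 i, fun s t =>
      (dist_pi_le_iff (abs_nonneg _)).1 (h s t) i⟩
  · intro h
    exact ⟨funext fun i => (h i).1, funext fun i => (h i).2.1, fun s t =>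
      (dist_pi_le_iff (abs_nonneg _)).2 fun i => (h i).2.2 s t⟩

theorem geodesicsFrom_pi_finite_iff (x y : ∀ i, Y i) :
    (GeodesicsFrom x y).Finite ↔
      (univ.pi fun i => LipschitzPaths (dist_nonneg (x := x) (y := y)) (x i) (y i)).Finite := by
  rw [← image_geodesicsFrom_pi, Set.finite_image_iff (Equiv.injective _).injOn]

theorem geodesicsFrom_pi_nontrivial_iff (hY : ∀ i, IsGeodesicSpace (Y i)) (x y : ∀ i, Y i) :
    (GeodesicsFrom x y).Nontrivial ↔
      ∃ i, (LipschitzPaths (dist_nonneg (x := x) (y := y)) (x i) (y i)).Nontrivial := by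
  classical
  rw [← image_nontrivial (Equiv.injective (Equiv.piComm fun (_ : Icc (0 : ℝ) (dist x y)) i => Y i)),
    image_geodesicsFrom_pi]
  constructor
  · rintro ⟨γ, hγ, γ', hγ', hne⟩
    obtain ⟨i, hi⟩ := Function.ne_iff.1 hne
    exact ⟨i, γ i, hγ i trivial, γ' i, hγ' i trivial, hi⟩
  · rintro ⟨i, a, ha, b, hb, hab⟩
    choose c hc using fun i => lipschitzPaths_nonempty (hY i) dist_nonneg (dist_le_pi_dist x y i)
    refine ⟨Function.update c i a, ?_, Function.update c i b, ?_, fun h => hab ?_⟩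
    · exact update_mem_pi_iff_of_mem (fun i _ => hc i) |>.2 fun _ => ha
    · exact update_mem_pi_iff_of_mem (fun i _ => hc i) |>.2 fun _ => hb
    · simpa using congrFun h i

/-- If only finitely many geodesics join two points of a product, then all coordinate distances
coincide. -/
theorem dist_eq_of_geodesicsFrom_pi_finite [∀ i, Nontrivial (Y i)]
    (hY : ∀ i, IsGeodesicSpace (Y i)) {x y : ∀ i, Y i} (h : (GeodesicsFrom x y).Finite) (i : ι) :
    dist (x i) (y i) = dist x y := by
  refine (dist_le_pi_dist x y i).eq_of_not_lt fun hlt => ?_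
  refine lipschitzPaths_infinite (hY i) dist_nonneg hlt ?_
  rw [geodesicsFrom_pi_finite_iff] at h
  have hne : (univ.pi fun i => LipschitzPaths (dist_nonneg (x := x) (y := y)) (x i) (y i)).Nonempty :=
    univ_pi_nonempty_iff.2 fun i =>
      lipschitzPaths_nonempty (hY i) dist_nonneg (dist_le_pi_dist x y i)
  rw [← eval_image_univ_pi hne]
  exact h.image _

/-- If all coordinate distances coincide, the number of geodesics is at most the product of
the coordinate bounds. -/
theorem geodesicsFrom_pi_finite_and_ncard_le {x y : ∀ i, Y i}
    (h : ∀ i, dist (x i) (y i) = dist x y) {N : ι → ℕ}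
    (hN : ∀ i, (GeodesicsFrom (x i) (y i)).Finite ∧ (GeodesicsFrom (x i) (y i)).ncard ≤ N i) :
    (GeodesicsFrom x y).Finite ∧ (GeodesicsFrom x y).ncard ≤ ∏ i, N i := by
  have hN' := fun i => (geodesicsFrom_eq_lipschitzPaths_of_eq dist_nonneg (h i)
    fun _ A => A.Finite ∧ A.ncard ≤ N i).1 (hN i)
  refine ⟨(geodesicsFrom_pi_finite_iff x y).2 (Finite.pi fun i => (hN' i).1), ?_⟩
  rw [← ncard_image_of_injective _ (Equiv.injective _), image_geodesicsFrom_pi,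
    ← Nat.card_coe_set_eq, Nat.card_congr (Equiv.Set.univPi _), Nat.card_pi]
  exact Finset.prod_le_prod' fun i _ => (hN' i).2

end Pi

theorem IsGeodesicSpace.exists_dist_eq {X : Type*} [MetricSpace X] (hX : IsGeodesicSpace X)
    {x w : X} {d : ℝ} (hd : 0 ≤ d) (h : d ≤ dist x w) : ∃ y, dist x y = d := by
  obtain ⟨g, hg⟩ := hX x w
  refine ⟨g ⟨d, hd, h⟩, ?_⟩
  have := hg.2.2 ⟨0, le_refl 0, dist_nonneg⟩ ⟨d, hd, h⟩
  rwa [hg.1, zero_sub, abs_neg, abs_of_nonneg hd] at this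

/-- Near a point with a coordinate in the bad set there are pairs of points with all coordinate
distances equal, one of whose coordinate pairs is joined by several geodesics. -/
theorem exists_dist_eq_of_mem_badSet {ι : Type*} [Fintype ι] {Y : ι → Type*}
    [∀ i, MetricSpace (Y i)] [∀ i, Nontrivial (Y i)] (hY : ∀ i, IsGeodesicSpace (Y i))
    {z : ∀ i, Y i} {i : ι} (hi : z i ∈ BadSet (Y i)) {U : Set (∀ i, Y i)} (hU : U ∈ nhds z) :
    ∃ x ∈ U, ∃ y ∈ U, (∀ j, dist (x j) (y j) = dist x y) ∧
      (GeodesicsFrom (x i) (y i)).Nontrivial := by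
  classical
  obtain ⟨ε, hε, hεU⟩ := Metric.mem_nhds_iff.1 hU
  choose w hw using fun j => exists_ne (z j)
  obtain ⟨δ, hδ, hδw⟩ : ∃ δ > 0, ∀ j, δ ≤ dist (z j) (w j) := by
    have hne : (Finset.univ : Finset ι).Nonempty := ⟨i, Finset.mem_univ i⟩
    refine ⟨Finset.univ.inf' hne fun j => dist (z j) (w j), ?_, fun j =>
      Finset.inf'_le _ (Finset.mem_univ j)⟩
    exact (Finset.lt_inf'_iff _).2 fun j _ => dist_pos.2 (hw j).symm
  have hr : 0 < min ε δ / 2 := half_pos (lt_min hε hδ)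
  obtain ⟨a, ha, b, hb, hab⟩ := hi _ (Metric.ball_mem_nhds _ hr)
  rw [Metric.mem_ball] at ha hb
  have hd : dist a b < min ε δ := by
    linarith [dist_triangle_right a b (z i)]
  choose v hv using fun j => (hY j).exists_dist_eq (dist_nonneg (x := a) (y := b))
    ((hd.le.trans (min_le_right _ _)).trans (hδw j))
  have hdist : ∀ j, dist (Function.update z i a j) (Function.update v i b j) = dist a b := by
    intro j
    rcases eq_or_ne j i with rfl | hj
    · simp
    · simpa [hj] using hv j
  refine ⟨Function.update z i a, hεU ?_, Function.update v i b, hεU ?_, fun j => ?_, by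
    rwa [Function.update_self, Function.update_self]⟩
  · refine (dist_pi_lt_iff hε).2 fun j => ?_
    rcases eq_or_ne j i with rfl | hj
    · simpa using ha.trans (by linarith [min_le_left ε δ])
    · simpa [hj] using hε
  · refine (dist_pi_lt_iff hε).2 fun j => ?_
    rcases eq_or_ne j i with rfl | hj
    · simpa using hb.trans (by linarith [min_le_left ε δ])
    · simpa [hj, dist_comm, hv j] using hd.trans_le (min_le_left _ _)
  · have : Nonempty ι := ⟨i⟩
    refine (dist_le_pi_dist _ _ j).antisymm ?_
    rw [hdist j]
    exact (dist_pi_le_iff dist_nonneg).2 fun k => (hdist k).le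

/-- Characterization of the set `⋃ i, Y₁ × ⋯ × S(Yᵢ) × ⋯ × Yₘ` in a sup-metric product of
geodesic metric spaces, each nontrivial and each with at most `N i` geodesics between any
two of its points: a point `z` has some coordinate in `S(Y i)` iff there is an integer
`N > 1` such that every neighborhood of `z` contains two points joined by more than one
but at most `N` geodesics; moreover one can take `N = N 1 ⋯ N m`. -/
theorem badSet_characterization
    {m : ℕ} (hm : 1 ≤ m) (Y : Fin m → Type*) [∀ i, MetricSpace (Y i)]
    [∀ i, Nontrivial (Y i)]
    (hgeo : ∀ i, IsGeodesicSpace (Y i))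
    (N : Fin m → ℕ) (hN : ∀ i, 1 ≤ N i)
    (hbound : ∀ i, ∀ x y : Y i,
      (GeodesicsFrom x y).Finite ∧ (GeodesicsFrom x y).ncard ≤ N i)
    (z : ∀ i, Y i) :
    ((∃ i, z i ∈ BadSet (Y i)) ↔
      ∃ Nb : ℕ, 1 < Nb ∧ ∀ U ∈ nhds z, ∃ x ∈ U, ∃ y ∈ U,
        (GeodesicsFrom x y).Nontrivial ∧ (GeodesicsFrom x y).Finite ∧
        (GeodesicsFrom x y).ncard ≤ Nb) ∧
    ((∃ i, z i ∈ BadSet (Y i)) →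
      ∀ U ∈ nhds z, ∃ x ∈ U, ∃ y ∈ U,
        (GeodesicsFrom x y).Nontrivial ∧ (GeodesicsFrom x y).Finite ∧
        (GeodesicsFrom x y).ncard ≤ ∏ i, N i) := by
  have forward : (∃ i, z i ∈ BadSet (Y i)) →
      ∀ U ∈ nhds z, ∃ x ∈ U, ∃ y ∈ U,
        (GeodesicsFrom x y).Nontrivial ∧ (GeodesicsFrom x y).Finite ∧
        (GeodesicsFrom x y).ncard ≤ ∏ i, N i := by
    rintro ⟨i, hi⟩ U hU
    obtain ⟨x, hx, y, hy, hd, hne⟩ := exists_dist_eq_of_mem_badSet hgeo hi hU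
    refine ⟨x, hx, y, hy, (geodesicsFrom_pi_nontrivial_iff hgeo x y).2 ⟨i, ?_⟩,
      geodesicsFrom_pi_finite_and_ncard_le hd fun i => hbound i _ _⟩
    exact (geodesicsFrom_eq_lipschitzPaths_of_eq dist_nonneg (hd i) fun _ A => A.Nontrivial).1 hne
  refine ⟨⟨fun h => ⟨∏ i, N i, ?_, forward h⟩, ?_⟩, forward⟩
  · obtain ⟨x, -, y, -, hne, hfin, hle⟩ := forward h univ Filter.univ_mem
    exact ((one_lt_ncard_iff_nontrivial_and_finite).2 ⟨hne, hfin⟩).trans_le hle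
  · rintro ⟨Nb, -, h⟩
    by_contra! hz
    have hV : ∀ i, ∃ V ∈ nhds (z i), ∀ x ∈ V, ∀ y ∈ V, ¬ (GeodesicsFrom x y).Nontrivial := by
      intro i
      simpa [BadSet] using hz i
    choose V hV hVne using hV
    obtain ⟨x, hx, y, hy, hne, hfin, -⟩ := h _ (set_pi_mem_nhds finite_univ fun i _ => hV i)
    obtain ⟨i, hi⟩ := (geodesicsFrom_pi_nontrivial_iff hgeo x y).1 hne
    refine hVne i _ (hx i trivial) _ (hy i trivial) ?_
    exact (geodesicsFrom_eq_lipschitzPaths_of_eq dist_nonneg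
      (dist_eq_of_geodesicsFrom_pi_finite hgeo hfin i) fun _ A => A.Nontrivial).2 hi
end

section
/- Fix a triangle T_0 = (a_1, a_2, a_3), i.e. three affinely independent points in ℝ². Then there exists a constant b > 0, depending only on T_0, with the following property: for all real numbers ε > 0 and R > 0 and all triples of points p_1, p_2, p_3 ∈ ℝ² lying on some circle of radius R, whose pairwise distances are all at least ε and at most R, there exist a permutation σ of {1,2,3} and an invertible affine map A : ℝ² → ℝ² with A(a_i) = p_{σ(i)} for i = 1,2,3, whose linear part L satisfies ‖L‖ · ‖L⁻¹‖ ≤ bR/ε. -/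
open EuclideanSpace

/-- The determinant of the pair of plane vectors `x`, `y`. -/
def planeDet (x y : EuclideanSpace ℝ (Fin 2)) : ℝ := x 0 * y 1 - x 1 * y 0

lemma norm_sq_eq_plane (x : EuclideanSpace ℝ (Fin 2)) : ‖x‖ ^ 2 = x 0 ^ 2 + x 1 ^ 2 := by
  simp [EuclideanSpace.real_norm_sq_eq]

lemma abs_planeDet_le (x y : EuclideanSpace ℝ (Fin 2)) : |planeDet x y| ≤ ‖x‖ * ‖y‖ := by
  apply abs_le_of_sq_le_sq _ (by positivity)
  rw [mul_pow, norm_sq_eq_plane, norm_sq_eq_plane, planeDet]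
  nlinarith [sq_nonneg (x 0 * y 0 + x 1 * y 1)]

/-- Cramer's rule in the plane. -/
lemma planeDet_smul_eq (u w y : EuclideanSpace ℝ (Fin 2)) :
    planeDet u w • y = planeDet y w • u + planeDet u y • w := by
  ext i
  fin_cases i <;> simp [planeDet] <;> ring

lemma linearIndependent_of_planeDet_ne_zero {u w : EuclideanSpace ℝ (Fin 2)}
    (h : planeDet u w ≠ 0) : LinearIndependent ℝ ![u, w] := by
  rw [LinearIndependent.pair_iff]
  intro s t hst
  have h0 := congrArg (fun x : EuclideanSpace ℝ (Fin 2) => x 0) hst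
  have h1 := congrArg (fun x : EuclideanSpace ℝ (Fin 2) => x 1) hst
  simp only [PiLp.add_apply, PiLp.smul_apply, PiLp.zero_apply, smul_eq_mul] at h0 h1
  constructor
  · apply (mul_eq_zero.mp _).resolve_right h
    rw [planeDet]
    linear_combination w 1 * h0 - w 0 * h1
  · apply (mul_eq_zero.mp _).resolve_right h
    rw [planeDet]
    linear_combination u 0 * h1 - u 1 * h0

/-- The product of the side lengths of a triangle is four times the area times the
circumradius. -/
lemma norm_mul_norm_mul_norm_sub_eq {u w z : EuclideanSpace ℝ (Fin 2)} {R : ℝ}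
    (hz : ‖z‖ = R) (hu : ‖z - u‖ = R) (hw : ‖z - w‖ = R) :
    ‖u‖ * ‖w‖ * ‖u - w‖ = 2 * R * |planeDet u w| := by
  have hR : 0 ≤ R := hz ▸ norm_nonneg z
  rw [← sq_eq_sq₀ (by positivity) (by positivity)]
  have e0 := norm_sq_eq_plane z
  have e1 := norm_sq_eq_plane (z - u)
  have e2 := norm_sq_eq_plane (z - w)
  rw [hz] at e0
  rw [hu] at e1
  rw [hw] at e2
  simp only [mul_pow, sq_abs, norm_sq_eq_plane, PiLp.sub_apply, planeDet] at *
  have hzu : u 0 ^ 2 + u 1 ^ 2 = 2 * (z 0 * u 0 + z 1 * u 1) := by linear_combination e0 - e1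
  have hzw : w 0 ^ 2 + w 1 ^ 2 = 2 * (z 0 * w 0 + z 1 * w 1) := by linear_combination e0 - e2
  have expand : (u 0 ^ 2 + u 1 ^ 2) * (w 0 ^ 2 + w 1 ^ 2) * ((u 0 - w 0) ^ 2 + (u 1 - w 1) ^ 2) =
      ((u 0 ^ 2 + u 1 ^ 2) * w 0 - (w 0 ^ 2 + w 1 ^ 2) * u 0) ^ 2 +
      ((u 0 ^ 2 + u 1 ^ 2) * w 1 - (w 0 ^ 2 + w 1 ^ 2) * u 1) ^ 2 := by ring
  rw [expand, hzu, hzw, e0]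
  ring

/-- The inverse of a linear bijection of the plane is bounded in terms of the images of two
vectors, relative to the determinant of these images. -/
lemma norm_symm_le_of_planeDet
    (L : EuclideanSpace ℝ (Fin 2) ≃L[ℝ] EuclideanSpace ℝ (Fin 2))
    (e f : EuclideanSpace ℝ (Fin 2)) (h : planeDet (L e) (L f) ≠ 0) :
    ‖(L.symm : EuclideanSpace ℝ (Fin 2) →L[ℝ] EuclideanSpace ℝ (Fin 2))‖ ≤
      (‖e‖ + ‖f‖) * (‖L e‖ + ‖L f‖) / |planeDet (L e) (L f)| := by
  have hpos := abs_pos.mpr h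
  refine ContinuousLinearMap.opNorm_le_bound _ (by positivity) fun y => ?_
  have key := congrArg (fun x => ‖L.symm x‖) (planeDet_smul_eq (L e) (L f) y)
  simp only [map_add, map_smul, ContinuousLinearEquiv.symm_apply_apply, norm_smul,
    Real.norm_eq_abs] at key
  rw [div_mul_eq_mul_div, le_div_iff₀ hpos, ContinuousLinearEquiv.coe_coe, mul_comm, key]
  calc _ ≤ |planeDet y (L f)| * ‖e‖ + |planeDet (L e) y| * ‖f‖ := by
        simpa [norm_smul] using
          norm_add_le (planeDet y (L f) • e) (planeDet (L e) y • f)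
    _ ≤ ‖y‖ * ‖L f‖ * ‖e‖ + ‖L e‖ * ‖y‖ * ‖f‖ := by
        gcongr <;> exact abs_planeDet_le _ _
    _ ≤ _ := by
        have : 0 ≤ ‖y‖ * ‖L e‖ * ‖e‖ + ‖y‖ * ‖L f‖ * ‖f‖ := by positivity
        linarith

lemma sq_add_mul_le_of_triangle {x y d ε : ℝ} (hε : 0 < ε) (hx : ε ≤ x) (hy : ε ≤ y)
    (hd : ε ≤ d) (hxy : x ≤ y + d) (hyx : y ≤ x + d) :
    (x + y) ^ 2 * ε ≤ 8 * (x * y * d) := by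
  have hx0 := hε.trans_le hx
  have hy0 := hε.trans_le hy
  have hd0 := hε.trans_le hd
  have h1 : x * ε ≤ 2 * (y * d) := by
    nlinarith [mul_le_mul_of_nonneg_right hxy hε.le, mul_le_mul_of_nonneg_left hd hy0.le,
      mul_le_mul_of_nonneg_right hy hd0.le]
  have h2 : y * ε ≤ 2 * (x * d) := by
    nlinarith [mul_le_mul_of_nonneg_right hyx hε.le, mul_le_mul_of_nonneg_left hd hx0.le,
      mul_le_mul_of_nonneg_right hx hd0.le]
  nlinarith [mul_le_mul_of_nonneg_left h1 hx0.le, mul_le_mul_of_nonneg_left h2 hy0.le,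
    mul_nonneg (sq_nonneg (x - y)) hε.le]

lemma AffineIndependent.linearIndependent_pair_sub {V : Type*} [AddCommGroup V] [Module ℝ V]
    {a : Fin 3 → V} (ha : AffineIndependent ℝ a) :
    LinearIndependent ℝ ![a 1 - a 0, a 2 - a 0] := by
  have h := ((affineIndependent_iff_linearIndependent_vsub ℝ a 0).mp ha).comp
    (fun i : Fin 2 => (⟨i.succ, Fin.succ_ne_zero i⟩ : {x : Fin 3 // x ≠ 0}))
    (fun i j hij => Fin.succ_injective _ (congrArg Subtype.val hij))
  have heq : ![a 1 - a 0, a 2 - a 0] = (fun i : {x : Fin 3 // x ≠ 0} => a i -ᵥ a 0) ∘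
      fun i : Fin 2 => ⟨i.succ, Fin.succ_ne_zero i⟩ := by
    ext i
    fin_cases i <;> rfl
  rwa [heq]

/-- Euclidean triangle lemma: fix a triangle `T₀ = (a 0, a 1, a 2)` in `ℝ²` (three
affinely independent points).  Then there is a constant `b > 0`, depending only on
`T₀`, such that for all `ε, R > 0` and every triple of points `p 0, p 1, p 2`
inscribed in a circle of radius `R` whose pairwise distances are at least `ε` and at
most `R`, there is an invertible affine map (given by an invertible linear map `L` and
a translation `v`) taking the vertices of `T₀` to the points `p`, up to a permutation
`σ`, whose linear part has condition number (quasiconformal dilatation)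
`‖L‖ * ‖L⁻¹‖ ≤ b * R / ε`. -/
theorem euclidean_triangle_lemma
    (a : Fin 3 → EuclideanSpace ℝ (Fin 2)) (ha : AffineIndependent ℝ a) :
    ∃ b : ℝ, 0 < b ∧
      ∀ (ε R : ℝ), 0 < ε → 0 < R →
      ∀ p : Fin 3 → EuclideanSpace ℝ (Fin 2),
        (∃ c : EuclideanSpace ℝ (Fin 2), ∀ i, dist c (p i) = R) →
        (∀ i j, i ≠ j → ε ≤ dist (p i) (p j) ∧ dist (p i) (p j) ≤ R) →
        ∃ (σ : Equiv.Perm (Fin 3))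
          (L : EuclideanSpace ℝ (Fin 2) ≃L[ℝ] EuclideanSpace ℝ (Fin 2))
          (v : EuclideanSpace ℝ (Fin 2)),
          (∀ i, L (a i) + v = p (σ i)) ∧
          ‖(L : EuclideanSpace ℝ (Fin 2) →L[ℝ] EuclideanSpace ℝ (Fin 2))‖ *
            ‖(L.symm : EuclideanSpace ℝ (Fin 2) →L[ℝ] EuclideanSpace ℝ (Fin 2))‖ ≤
            b * R / ε := by
  have hcard : Fintype.card (Fin 2) = Module.finrank ℝ (EuclideanSpace ℝ (Fin 2)) := by simp
  let B := basisOfLinearIndependentOfCardEqFinrank ha.linearIndependent_pair_sub hcard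
  have hB0 : B 0 = a 1 - a 0 := by simp [B]
  have hB1 : B 1 = a 2 - a 0 := by simp [B]
  obtain ⟨K, hK, hBK⟩ := B.exists_opNorm_le (F := EuclideanSpace ℝ (Fin 2))
  have hBpos : 0 < ‖B 0‖ := norm_pos_iff.mpr (B.ne_zero 0)
  refine ⟨16 * K * (‖B 0‖ + ‖B 1‖), by positivity, ?_⟩
  rintro ε R hε hR p ⟨c, hc⟩ hp
  set u := p 1 - p 0 with hu
  set w := p 2 - p 0 with hw
  have hεu : ε ≤ ‖u‖ := by simpa [hu, dist_eq_norm] using (hp 1 0 (by decide)).1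
  have hεw : ε ≤ ‖w‖ := by simpa [hw, dist_eq_norm] using (hp 2 0 (by decide)).1
  have hεd : ε ≤ ‖u - w‖ := by simpa [hu, hw, dist_eq_norm] using (hp 1 2 (by decide)).1
  have harea : ‖u‖ * ‖w‖ * ‖u - w‖ = 2 * R * |planeDet u w| :=
    norm_mul_norm_mul_norm_sub_eq (z := c - p 0) (by simpa [dist_eq_norm] using hc 0)
      (by simpa [hu, dist_eq_norm] using hc 1) (by simpa [hw, dist_eq_norm] using hc 2)
  have hdet : planeDet u w ≠ 0 := by
    intro h
    have : 0 < ‖u‖ * ‖w‖ * ‖u - w‖ :=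
      mul_pos (mul_pos (hε.trans_le hεu) (hε.trans_le hεw)) (hε.trans_le hεd)
    simp [harea, h] at this
  let C := basisOfLinearIndependentOfCardEqFinrank
    (linearIndependent_of_planeDet_ne_zero hdet) hcard
  let L := (B.equiv C (Equiv.refl _)).toContinuousLinearEquiv
  have hL0 : L (B 0) = u := by simp [L, C]
  have hL1 : L (B 1) = w := by simp [L, C]
  refine ⟨Equiv.refl _, L, p 0 - L (a 0), ?_, ?_⟩
  · have e0 := hL0
    have e1 := hL1
    rw [hB0, map_sub] at e0
    rw [hB1, map_sub] at e1
    intro i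
    fin_cases i
    · simp
    · simp only [Fin.mk_one, Equiv.refl_apply]
      rw [add_sub_left_comm, e0, hu, add_sub_cancel]
    · simp only [Fin.reduceFinMk, Equiv.refl_apply]
      rw [add_sub_left_comm, e1, hw, add_sub_cancel]
  have hnorm : ‖(L : EuclideanSpace ℝ (Fin 2) →L[ℝ] EuclideanSpace ℝ (Fin 2))‖ ≤
      K * (‖u‖ + ‖w‖) := by
    refine hBK (by positivity) fun i => ?_
    fin_cases i
    · simp [hL0]
    · simp [hL1]
  have hsymm := norm_symm_le_of_planeDet L (B 0) (B 1) (by rwa [hL0, hL1])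
  rw [hL0, hL1] at hsymm
  have hshape := sq_add_mul_le_of_triangle hε hεu hεw hεd
    (by simpa using norm_add_le w (u - w))
    (by simpa [norm_sub_rev w u] using norm_add_le u (w - u))
  rw [harea] at hshape
  have hpos := abs_pos.mpr hdet
  refine (mul_le_mul hnorm hsymm (norm_nonneg _) (by positivity)).trans ?_
  rw [mul_div_assoc', div_le_div_iff₀ hpos hε]
  have := mul_le_mul_of_nonneg_left hshape
    (by positivity : 0 ≤ K * (‖B 0‖ + ‖B 1‖))
  linarith
end

section
/- Let (X,d) be a metric space and r : [0,∞) → X any map. Then the following are equivalent: (a) there exist constants C ≥ 0 and t_0 ≥ 0 such that d(r(t), r(t_0)) ≥ (t − t_0) − C for all t ≥ t_0 (i.e., r is almost distance minimizing); (b) for every ε > 0 there exists t_0 ≥ 0 such that d(r(t), r(t_0)) ≥ (t − t_0) − ε for all t ≥ t_0. -/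
/-- A map `r : [0,∞) → X` is almost distance minimizing (ADM), i.e. there exist
`C ≥ 0` and `t₀ ≥ 0` with `dist (r t) (r t₀) ≥ (t - t₀) - C` for all `t ≥ t₀`, if and
only if for every `ε > 0` there is `t₀ ≥ 0` with `dist (r t) (r t₀) ≥ (t - t₀) - ε`
for all `t ≥ t₀`. -/
theorem adm_iff_eps {X : Type*} [MetricSpace X] (r : ℝ → X) :
    (∃ C ≥ (0 : ℝ), ∃ t₀ ≥ (0 : ℝ), ∀ t ≥ t₀, dist (r t) (r t₀) ≥ (t - t₀) - C) ↔
    (∀ ε > (0 : ℝ), ∃ t₀ ≥ (0 : ℝ), ∀ t ≥ t₀, dist (r t) (r t₀) ≥ (t - t₀) - ε) := by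
  constructor
  · rintro ⟨C, -, t₀, ht₀, h⟩ ε hε
    by_contra! hcon
    have key : ∀ n : ℕ, ∃ t ≥ t₀, dist (r t) (r t₀) ≤ (t - t₀) - n * ε := by
      intro n
      induction n with
      | zero => exact ⟨t₀, le_rfl, by simp⟩
      | succ n ih =>
        obtain ⟨s, hs, hd⟩ := ih
        obtain ⟨t, ht, hlt⟩ := hcon s (ht₀.le.trans hs)
        refine ⟨t, hs.le.trans ht, ?_⟩
        have := dist_triangle (r t) (r s) (r t₀)
        push_cast
        linarith
    obtain ⟨n, hn⟩ := exists_nat_gt (C / ε)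
    obtain ⟨t, ht, hd⟩ := key n
    have hC := (div_lt_iff₀ hε).mp hn
    linarith [h t ht]
  · intro h
    exact ⟨1, zero_le_one, h 1 one_pos⟩
end

section
/- Let (X,d) be a metric space, let φ : X → X be an isometry (d(φ(x), φ(y)) = d(x,y) for all x,y), let k ≥ 1 be an integer, let t_0 < t_1 < ⋯ < t_k be real numbers, and let r be a map into X defined on [t_0, t_k] satisfying d(r(s), r(t)) = |s − t| for all s, t ∈ [t_0, t_k]. If d(r(t_{i−1}), φ(r(t_i))) < d(r(t_{i−1}), r(t_i)) for every i ∈ {1, …, k}, then d(r(t_0), φ^k(r(t_k))) < d(r(t_0), r(t_k)), where φ^k denotes the k-fold iterate of φ. -/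
/-- Iterating an isometry along a chain of points: the distance from the first point to the
`k`-th iterate of the last is at most the sum of the one-step displaced distances. -/
theorem dist_iterate_le_sum_dist {X : Type*} [PseudoMetricSpace X] {φ : X → X}
    (hφ : Isometry φ) (x : ℕ → X) (k : ℕ) :
    dist (x 0) (φ^[k] (x k)) ≤ ∑ i ∈ Finset.range k, dist (x i) (φ (x (i + 1))) := by
  induction k with
  | zero => simp
  | succ k ih =>
    have hiter : Isometry φ^[k] := by
      clear ih
      induction k with
      | zero => exact isometry_id
      | succ k ih => exact ih.comp hφ
    rw [Finset.sum_range_succ, Function.iterate_succ_apply]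
    calc dist (x 0) (φ^[k] (φ (x (k + 1))))
        ≤ dist (x 0) (φ^[k] (x k)) + dist (φ^[k] (x k)) (φ^[k] (φ (x (k + 1)))) :=
          dist_triangle _ _ _
      _ ≤ _ := by rw [hiter.dist_eq]; gcongr

/-- If `r` is a unit-speed geodesic on `[t 0, t k]` in a metric space `X`, `φ` is an
isometry of `X`, and `dist (r (t i)) (φ (r (t (i+1)))) < dist (r (t i)) (r (t (i+1)))`
for every `i < k`, then `dist (r (t 0)) (φ^[k] (r (t k))) < dist (r (t 0)) (r (t k))`. -/
theorem iterate_isometry_strict_ineq {X : Type*} [MetricSpace X]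
    (φ : X → X) (hφ : ∀ x y : X, dist (φ x) (φ y) = dist x y)
    (k : ℕ) (hk : 1 ≤ k) (t : ℕ → ℝ) (ht : ∀ i < k, t i < t (i + 1))
    (r : ℝ → X)
    (hr : ∀ s ∈ Set.Icc (t 0) (t k), ∀ u ∈ Set.Icc (t 0) (t k),
      dist (r s) (r u) = |s - u|)
    (h : ∀ i < k, dist (r (t i)) (φ (r (t (i + 1)))) < dist (r (t i)) (r (t (i + 1)))) :
    dist (r (t 0)) (φ^[k] (r (t k))) < dist (r (t 0)) (r (t k)) := by
  have hmono : MonotoneOn t (Set.Iic k) :=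
    monotoneOn_of_le_add_one Set.ordConnected_Iic fun i _ _ hi => (ht i hi).le
  have hmem : ∀ i ≤ k, t i ∈ Set.Icc (t 0) (t k) := fun i hi =>
    ⟨hmono (Nat.zero_le k) hi (Nat.zero_le i), hmono hi Set.self_mem_Iic hi⟩
  calc dist (r (t 0)) (φ^[k] (r (t k)))
      ≤ ∑ i ∈ Finset.range k, dist (r (t i)) (φ (r (t (i + 1)))) :=
        dist_iterate_le_sum_dist (Isometry.of_dist_eq hφ) (fun i => r (t i)) k
    _ < ∑ i ∈ Finset.range k, dist (r (t i)) (r (t (i + 1))) :=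
        Finset.sum_lt_sum_of_nonempty (Finset.nonempty_range_iff.2 (by lia))
          fun i hi => h i (Finset.mem_range.1 hi)
    _ = ∑ i ∈ Finset.range k, (t (i + 1) - t i) := by
        refine Finset.sum_congr rfl fun i hi => ?_
        have hi := Finset.mem_range.1 hi
        rw [hr _ (hmem i hi.le) _ (hmem (i + 1) hi), abs_sub_comm,
          abs_of_pos (sub_pos.2 (ht i hi))]
    _ = dist (r (t 0)) (r (t k)) := by
        rw [Finset.sum_range_sub, hr _ (hmem 0 k.zero_le) _ (hmem k le_rfl), abs_sub_comm,
          abs_of_nonneg (sub_nonneg.2 (hmem k le_rfl).1)]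
end

section
/- Let z and w be points of the hyperbolic upper half-plane ℍ, and let L : ℝ² → ℝ² be the unique linear map with L(1,0) = (1,0) and L(Re z, Im z) = (Re w, Im w). Then L is invertible (its determinant is Im w / Im z > 0) and its quasiconformal dilatation equals exp(d_ℍ(z,w)); that is, ‖L‖ · ‖L⁻¹‖ = exp(d_ℍ(z,w)), where ‖·‖ is the Euclidean operator norm. (This is the assertion that the affine Teichmüller map between the marked flat tori determined by z and w has dilatation e^{2d_0}, where d_0 = d_ℍ(z,w)/2 is the Teichmüller distance; in particular, for z = iR_1 and w = n + iR_2 the map L has matrix [[1, n/R_1],[0, R_2/R_1]].) -/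
open UpperHalfPlane

/-- The linear map of the Euclidean plane with matrix `[[1, a], [0, b]]`. -/
noncomputable def shearScale (a b : ℝ) :
    EuclideanSpace ℝ (Fin 2) →L[ℝ] EuclideanSpace ℝ (Fin 2) :=
  LinearMap.toContinuousLinearMap
    { toFun := fun v => !₂[v 0 + a * v 1, b * v 1]
      map_add' := by
        intro u v
        ext i
        fin_cases i <;> simp <;> ring
      map_smul' := by
        intro c v
        ext i
        fin_cases i <;> simp <;> ring }

@[simp]
lemma shearScale_apply (a b : ℝ) (v : EuclideanSpace ℝ (Fin 2)) :
    shearScale a b v = !₂[v 0 + a * v 1, b * v 1] := rfl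

lemma shearScale_leftInverse (a : ℝ) {b : ℝ} (hb : b ≠ 0) :
    Function.LeftInverse (shearScale (-a / b) b⁻¹) (shearScale a b) := by
  intro v
  ext i
  fin_cases i
  · simp
    field_simp
    ring
  · simp [hb]

lemma shearScale_rightInverse (a : ℝ) {b : ℝ} (hb : b ≠ 0) :
    Function.RightInverse (shearScale (-a / b) b⁻¹) (shearScale a b) := by
  intro v
  ext i
  fin_cases i
  · simp
    field_simp
    ring
  · simp [hb]

lemma det_shearScale (a b : ℝ) :
    LinearMap.det (shearScale a b : EuclideanSpace ℝ (Fin 2) →ₗ[ℝ] EuclideanSpace ℝ (Fin 2)) =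
      b := by
  rw [← LinearMap.det_toMatrix (EuclideanSpace.basisFun (Fin 2) ℝ).toBasis, Matrix.det_fin_two]
  simp [LinearMap.toMatrix_apply]

/-- The operator norm of `shearScale a b` is the square root of the larger eigenvalue `b * E`
of its Gram matrix. -/
lemma norm_shearScale {a b E : ℝ} (hb : 0 < b) (hE : 1 ≤ E)
    (h : a ^ 2 + 1 + b ^ 2 = b * (E + E⁻¹)) :
    ‖shearScale a b‖ = √(b * E) := by
  have hE0 : 0 < E := by linarith
  have hEi : E⁻¹ ≤ 1 := inv_le_one_of_one_le₀ hE
  have hl : 0 ≤ b * E := by positivity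
  have hdet : (b * E - 1) * (b * E - a ^ 2 - b ^ 2) = a ^ 2 := by
    have : b * E * (a ^ 2 + 1 + b ^ 2) = (b * E) ^ 2 + b ^ 2 := by
      rw [h]
      field_simp
    linarith
  have htr : 0 ≤ (b * E - 1) + (b * E - a ^ 2 - b ^ 2) := by
    nlinarith
  have hp : 0 ≤ b * E - 1 := by nlinarith [sq_nonneg a]
  have hq : 0 ≤ b * E - a ^ 2 - b ^ 2 := by nlinarith [sq_nonneg a]
  refine ContinuousLinearMap.opNorm_eq_of_bounds (Real.sqrt_nonneg _) ?_ ?_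
  · intro v
    rw [EuclideanSpace.norm_eq, EuclideanSpace.norm_eq, ← Real.sqrt_mul hl]
    apply Real.sqrt_le_sqrt
    simp only [Fin.sum_univ_two, Real.norm_eq_abs, sq_abs, shearScale_apply]
    simp only [Matrix.cons_val_zero, Matrix.cons_val_one]
    generalize v 0 = x
    generalize v 1 = y
    set p := b * E - 1 with hpd
    set q := b * E - a ^ 2 - b ^ 2 with hqd
    have key : 0 ≤ p * x ^ 2 - 2 * a * x * y + q * y ^ 2 := by
      rcases hp.eq_or_lt with h0 | h0
      · have ha : a = 0 := by
          rw [← h0, zero_mul] at hdet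
          exact pow_eq_zero_iff two_ne_zero |>.1 hdet.symm
        rw [← h0, ha]
        nlinarith [mul_nonneg hq (sq_nonneg y)]
      · refine nonneg_of_mul_nonneg_right (a := p) ?_ h0
        have : p * (p * x ^ 2 - 2 * a * x * y + q * y ^ 2) = (p * x - a * y) ^ 2 := by
          linear_combination y ^ 2 * hdet
        rw [this]
        positivity
    nlinarith
  · intro N hN hbound
    obtain ⟨x, y, hxy, heq⟩ : ∃ x y : ℝ, 0 < x ^ 2 + y ^ 2 ∧
        (x + a * y) ^ 2 + (b * y) ^ 2 = b * E * (x ^ 2 + y ^ 2) := by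
      rcases hp.eq_or_lt with h0 | h0
      · exact ⟨1, 0, by norm_num, by linarith⟩
      · exact ⟨a, b * E - 1, by positivity, by linear_combination (1 - b * E) * hdet⟩
    have hv := hbound !₂[x, y]
    rw [EuclideanSpace.norm_eq, EuclideanSpace.norm_eq] at hv
    simp only [Fin.sum_univ_two, Real.norm_eq_abs, sq_abs, shearScale_apply] at hv
    simp only [Matrix.cons_val_zero, Matrix.cons_val_one] at hv
    rw [heq, Real.sqrt_mul hl] at hv
    exact le_of_mul_le_mul_right hv (Real.sqrt_pos.2 hxy)

lemma eq_shearScale (z w : UpperHalfPlane)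
    (L : EuclideanSpace ℝ (Fin 2) →L[ℝ] EuclideanSpace ℝ (Fin 2))
    (hL1 : L !₂[1, 0] = !₂[1, 0]) (hLz : L !₂[z.re, z.im] = !₂[w.re, w.im]) :
    L = shearScale ((w.re - z.re) / z.im) (w.im / z.im) := by
  have hz := z.im_ne_zero
  ext v i
  have hv : v = (v 0 - v 1 / z.im * z.re) • !₂[(1 : ℝ), 0] + (v 1 / z.im) • !₂[z.re, z.im] := by
    ext j
    fin_cases j <;> simp [hz]
  have hLv : L v = (v 0 - v 1 / z.im * z.re) • !₂[(1 : ℝ), 0]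
      + (v 1 / z.im) • !₂[w.re, w.im] := by
    conv_lhs => rw [hv]
    rw [map_add, map_smul, map_smul, hL1, hLz]
  rw [hLv]
  fin_cases i
  · simp
    ring
  · simp
    ring

lemma exp_dist_add_inv (z w : UpperHalfPlane) :
    ((w.re - z.re) / z.im) ^ 2 + 1 + (w.im / z.im) ^ 2 =
      w.im / z.im * (Real.exp (dist z w) + (Real.exp (dist z w))⁻¹) := by
  have hz := z.im_ne_zero
  have hw := w.im_ne_zero
  have h := UpperHalfPlane.cosh_dist' z w
  rw [Real.cosh_eq, Real.exp_neg] at h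
  have h2 : Real.exp (dist z w) + (Real.exp (dist z w))⁻¹ =
    2 * (((z.re - w.re) ^ 2 + z.im ^ 2 + w.im ^ 2) / (2 * z.im * w.im)) := by linarith
  rw [h2]
  field_simp
  ring

/-- Let `z, w` be points of the hyperbolic upper half-plane and let `L` be the (unique)
linear map of `ℝ²` with `L (1,0) = (1,0)` and `L (Re z, Im z) = (Re w, Im w)`.  Then
`L` is invertible, its determinant is `Im w / Im z`, and its quasiconformal dilatation
(the condition number `‖L‖ * ‖L⁻¹‖` in the Euclidean operator norm) equals
`exp (dist z w)`, the exponential of the hyperbolic distance. -/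
theorem teichmuller_dilatation_eq_exp_hyperbolic_dist
    (z w : UpperHalfPlane)
    (L : EuclideanSpace ℝ (Fin 2) →L[ℝ] EuclideanSpace ℝ (Fin 2))
    (hL1 : L ((WithLp.equiv 2 (Fin 2 → ℝ)).symm ![1, 0]) =
      (WithLp.equiv 2 (Fin 2 → ℝ)).symm ![1, 0])
    (hLz : L ((WithLp.equiv 2 (Fin 2 → ℝ)).symm ![z.re, z.im]) =
      (WithLp.equiv 2 (Fin 2 → ℝ)).symm ![w.re, w.im]) :
    ∃ L' : EuclideanSpace ℝ (Fin 2) ≃L[ℝ] EuclideanSpace ℝ (Fin 2),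
      (L' : EuclideanSpace ℝ (Fin 2) →L[ℝ] EuclideanSpace ℝ (Fin 2)) = L ∧
      LinearMap.det (L : EuclideanSpace ℝ (Fin 2) →ₗ[ℝ] EuclideanSpace ℝ (Fin 2)) =
        w.im / z.im ∧
      0 < w.im / z.im ∧
      ‖L‖ * ‖(L'.symm : EuclideanSpace ℝ (Fin 2) →L[ℝ] EuclideanSpace ℝ (Fin 2))‖ =
        Real.exp (dist z w) := by
  obtain rfl := eq_shearScale z w L hL1 hLz
  have hsum := exp_dist_add_inv z w
  have hb : 0 < w.im / z.im := div_pos w.im_pos z.im_pos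
  have hE : 1 ≤ Real.exp (dist z w) := Real.one_le_exp dist_nonneg
  generalize (w.re - z.re) / z.im = a at *
  generalize w.im / z.im = b at *
  generalize Real.exp (dist z w) = E at *
  have hsum' : (-a / b) ^ 2 + 1 + b⁻¹ ^ 2 = b⁻¹ * (E + E⁻¹) := by
    have : (-a / b) ^ 2 + 1 + b⁻¹ ^ 2 = (a ^ 2 + 1 + b ^ 2) / b ^ 2 := by
      field_simp
      ring
    rw [this, hsum]
    field_simp
  refine ⟨ContinuousLinearEquiv.equivOfInverse (shearScale a b) (shearScale (-a / b) b⁻¹)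
    (shearScale_leftInverse a hb.ne') (shearScale_rightInverse a hb.ne'), rfl,
    det_shearScale a b, hb, ?_⟩
  change ‖shearScale a b‖ * ‖shearScale (-a / b) b⁻¹‖ = E
  rw [norm_shearScale hb hE hsum, norm_shearScale (inv_pos.2 hb) hE hsum',
    ← Real.sqrt_mul (by positivity)]
  have : b * E * (b⁻¹ * E) = E ^ 2 := by field_simp
  rw [this, Real.sqrt_sq (by linarith)]
end
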